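/- arXiv:1101.0485 — 2 statements merged into one kernel-verified Lean document; each statement's English description precedes it below -/
import Mathlib

section
/- With respect to the ℤ₂×ℤ₂-grading induced on Der(J) for J = JCK(Z,δ): (i) Der(J)₀^{[0,0]} = {∂̃ : ∂ ∈ Der(K)₀}, where for an even derivation ∂ of K with ∂|_Z = μ and ∂(x) = ax, ∂̃ denotes the unique even derivation of J with ∂̃|_K = ∂, ∂̃(fwᵢ) = μ(f)wᵢ and ∂̃(fxᵢ) = (μ(f) − af)xᵢ for all f ∈ Z, i = 1,2,3; (ii) Inder(J)₀^{[0,0]} = D(x, Zx) = {∂̃ : ∂ = (aδ)ˇ for some a ∈ Z}, where D(x,Zx) is the F-span of {D(x, fx) : f ∈ Z}; (iii) Der(J)₀^{[1,0]} = D(w₂, Zw₃), Der(J)₀^{[0,1]} = D(w₃, Zw₁), and Der(J)₀^{[1,1]} = D(w₁, Zw₂), where D(wᵢ, Zwⱼ) is the F-span of {D(wᵢ, fwⱼ) : f ∈ Z}. -/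
namespace CKJ

variable (F : Type*) [Field F] {Z : Type*} [CommRing Z] [Algebra F Z]

/-- Underlying module of the Cheng–Kac Jordan superalgebra `JCK(Z,δ)`:
the even part has `Z`-coordinates `1, w₁, w₂, w₃` (indices `0,1,2,3`) and the
odd part has `Z`-coordinates `x, x₁, x₂, x₃` (indices `0,1,2,3`). -/
abbrev J (Z : Type*) := (Fin 4 → Z) × (Fin 4 → Z)

/-- The product of two even elements, in coordinates:
`w₁² = w₂² = 1`, `w₃² = -1`, `wᵢwⱼ = 0` for `i ≠ j`. -/
def emul (a c : Fin 4 → Z) : Fin 4 → Z :=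
  ![a 0 * c 0 + a 1 * c 1 + a 2 * c 2 - a 3 * c 3,
    a 0 * c 1 + a 1 * c 0,
    a 0 * c 2 + a 2 * c 0,
    a 0 * c 3 + a 3 * c 0]

/-- The product of two odd elements: `(fx)(gx) = δ(f)g - fδ(g)`,
`(fxᵢ)(gx) = (fg)wᵢ`, `(fx)(gxⱼ) = -(fg)wⱼ`, `(fxᵢ)(gxⱼ) = 0`. -/
def omul (δ : Z → Z) (b d : Fin 4 → Z) : Fin 4 → Z :=
  ![δ (b 0) * d 0 - b 0 * δ (d 0),
    b 1 * d 0 - b 0 * d 1,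
    b 2 * d 0 - b 0 * d 2,
    b 3 * d 0 - b 0 * d 3]

/-- The product of an even element by an odd element: `f(gx) = (fg)x`,
`f(gxⱼ) = (fg)xⱼ`, `(fwᵢ)(gx) = (δ(f)g)xᵢ`, `(fwᵢ)(gxⱼ) = -(fg)x_{i×j}`. -/
def eomul (δ : Z → Z) (a d : Fin 4 → Z) : Fin 4 → Z :=
  ![a 0 * d 0,
    a 0 * d 1 + δ (a 1) * d 0 + (a 2 * d 3 - a 3 * d 2),
    a 0 * d 2 + δ (a 2) * d 0 + (a 3 * d 1 - a 1 * d 3),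
    a 0 * d 3 + δ (a 3) * d 0 + (a 2 * d 1 - a 1 * d 2)]

/-- The (supercommutative) multiplication of the Cheng–Kac Jordan
superalgebra `JCK(Z,δ)`. -/
def jmul (δ : Z → Z) (u v : J Z) : J Z :=
  (emul u.1 v.1 + omul δ u.2 v.2, eomul δ u.1 v.2 + eomul δ v.1 u.2)

/-- `fw f k` is the even element `f·wₖ` (with the convention `w₀ = 1`). -/
def fw (f : Z) (k : Fin 4) : J Z := (fun j => if j = k then f else 0, 0)

/-- `fone f` is the even element `f·1`. -/
def fone (f : Z) : J Z := fw f 0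

/-- `fxi f k` is the odd element `f·xₖ` (with the convention `x₀ = x`). -/
def fxi (f : Z) (k : Fin 4) : J Z := (0, fun j => if j = k then f else 0)

/-- `fx f` is the odd element `f·x`. -/
def fx (f : Z) : J Z := fxi f 0

/-- The grading involution of the superalgebra `J` (identity on the even part,
minus the identity on the odd part). -/
def jsig (u : J Z) : J Z := (u.1, -u.2)

/-- `F`-linearity of a map `J → J`. -/
def IsLin (d : J Z → J Z) : Prop :=
  (∀ u v, d (u + v) = d u + d v) ∧ ∀ (c : F) (u), d (c • u) = c • d u

/-- `d` is an even derivation of the superalgebra `J = JCK(Z,δ)`. -/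
def IsDer0 (δ : Z → Z) (d : J Z → J Z) : Prop :=
  IsLin F d ∧ (∀ u : J Z, u.2 = 0 → (d u).2 = 0) ∧ (∀ u : J Z, u.1 = 0 → (d u).1 = 0) ∧
    ∀ u v, d (jmul δ u v) = jmul δ (d u) v + jmul δ u (d v)

/-- `d` is an odd derivation of the superalgebra `J = JCK(Z,δ)`. -/
def IsDer1 (δ : Z → Z) (d : J Z → J Z) : Prop :=
  IsLin F d ∧ (∀ u : J Z, u.2 = 0 → (d u).1 = 0) ∧ (∀ u : J Z, u.1 = 0 → (d u).2 = 0) ∧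
    ∀ u v, d (jmul δ u v) = jmul δ (d u) v + jmul δ (jsig u) (d v)

/-- The set `Der(J) = Der(J)₀ ⊕ Der(J)₁` of all derivations of `J`. -/
def DerJSet (δ : Z → Z) : Set (J Z → J Z) :=
  {d | ∃ d0 d1, IsDer0 F δ d0 ∧ IsDer1 F δ d1 ∧ d = d0 + d1}

/-- `u` is homogeneous of parity `p` (`p = true` means odd). -/
def IsHom (p : Bool) (u : J Z) : Prop := if p then u.1 = 0 else u.2 = 0

/-- `(-1)^{pq}` -/
def sgn (p q : Bool) : ℤ := if p && q then -1 else 1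

/-- `Dgen δ ε u v` is the inner derivation `D(u,v) : c ↦ u(vc) - ε·v(uc)`;
for homogeneous `u`, `v` one takes `ε = (-1)^{|u||v|}`. -/
def Dgen (δ : Z → Z) (ε : ℤ) (u v : J Z) : J Z → J Z :=
  fun c => jmul δ u (jmul δ v c) - ε • jmul δ v (jmul δ u c)

/-- Generators `D(u,v)`, `u`, `v` homogeneous, of `Inder(J)`. -/
def InderSet (δ : Z → Z) : Set (J Z → J Z) :=
  {d | ∃ u v p q, IsHom p u ∧ IsHom q v ∧ d = Dgen δ (sgn p q) u v}

/-- Generators of the even part `Inder(J)₀`. -/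
def InderSet0 (δ : Z → Z) : Set (J Z → J Z) :=
  {d | ∃ u v p, IsHom p u ∧ IsHom p v ∧ d = Dgen δ (sgn p p) u v}

/-- Generators of the odd part `Inder(J)₁`. -/
def InderSet1 (δ : Z → Z) : Set (J Z → J Z) :=
  {d | ∃ u v p, IsHom p u ∧ IsHom (!p) v ∧ d = Dgen δ 1 u v}

/-- Coordinate index of each sector of the `ℤ₂×ℤ₂`-grading:
`[0,0] ↦ 0`, `[1,0] ↦ 1`, `[0,1] ↦ 2`, `[1,1] ↦ 3`. -/
def idx (t : ZMod 2 × ZMod 2) : Fin 4 :=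
  if t = (0, 0) then 0 else if t = (1, 0) then 1 else if t = (0, 1) then 2 else 3

/-- The sector `J^{[t]}` of the `ℤ₂×ℤ₂`-grading of `J`:
`J^{[0,0]} = Z ⊕ Zx`, `J^{[1,0]} = Zw₁ ⊕ Zx₁`, `J^{[0,1]} = Zw₂ ⊕ Zx₂`,
`J^{[1,1]} = Zw₃ ⊕ Zx₃`. -/
def gset (t : ZMod 2 × ZMod 2) : Set (J Z) :=
  {u | ∀ k : Fin 4, k ≠ idx t → u.1 k = 0 ∧ u.2 k = 0}

/-- `d : J → J` has degree `t` with respect to the `ℤ₂×ℤ₂`-grading of `J`. -/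
def DerDeg (t : ZMod 2 × ZMod 2) (d : J Z → J Z) : Prop :=
  ∀ s u, u ∈ gset s → d u ∈ gset (s + t)

/-! The Kantor double superalgebra of vector type `K = Z ⊕ Zx`, realised
as `Z × Z`: the pair `(f, g)` represents `f + gx`. -/

/-- The multiplication of `K = Z ⊕ Zx`. -/
def kmul (δ : Z → Z) (u v : Z × Z) : Z × Z :=
  (u.1 * v.1 + (δ u.2 * v.2 - u.2 * δ v.2), u.1 * v.2 + v.1 * u.2)

/-- The grading involution of `K`. -/
def ksig (u : Z × Z) : Z × Z := (u.1, -u.2)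

/-- `F`-linearity of a map `K → K`. -/
def IsKLin (d : Z × Z → Z × Z) : Prop :=
  (∀ u v, d (u + v) = d u + d v) ∧ ∀ (c : F) (u), d (c • u) = c • d u

/-- `d` is an even derivation of `K = Z ⊕ Zx`. -/
def IsKDer0 (δ : Z → Z) (d : Z × Z → Z × Z) : Prop :=
  IsKLin F d ∧ (∀ u : Z × Z, u.2 = 0 → (d u).2 = 0) ∧ (∀ u : Z × Z, u.1 = 0 → (d u).1 = 0) ∧
    ∀ u v, d (kmul δ u v) = kmul δ (d u) v + kmul δ u (d v)

/-- `d` is an odd derivation of `K = Z ⊕ Zx`. -/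
def IsKDer1 (δ : Z → Z) (d : Z × Z → Z × Z) : Prop :=
  IsKLin F d ∧ (∀ u : Z × Z, u.2 = 0 → (d u).1 = 0) ∧ (∀ u : Z × Z, u.1 = 0 → (d u).2 = 0) ∧
    ∀ u v, d (kmul δ u v) = kmul δ (d u) v + kmul δ (ksig u) (d v)

/-- `Dk δ ε u v` is the inner derivation `D(u,v) : c ↦ u(vc) - ε·v(uc)` of `K`. -/
def Dk (δ : Z → Z) (ε : ℤ) (u v : Z × Z) : Z × Z → Z × Z :=
  fun c => kmul δ u (kmul δ v c) - ε • kmul δ v (kmul δ u c)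

/-- `u ∈ K` is homogeneous of parity `p`. -/
def KHom (p : Bool) (u : Z × Z) : Prop := if p then u.1 = 0 else u.2 = 0

/-- Generators `D(u,v)`, `u`, `v` homogeneous, of `Inder(K)`. -/
def InderKSet (δ : Z → Z) : Set (Z × Z → Z × Z) :=
  {d | ∃ u v p q, KHom p u ∧ KHom q v ∧ d = Dk δ (sgn p q) u v}

/-- Generators of the even part `Inder(K)₀`. -/
def InderKSet0 (δ : Z → Z) : Set (Z × Z → Z × Z) :=
  {d | ∃ u v p, KHom p u ∧ KHom p v ∧ d = Dk δ (sgn p p) u v}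

/-- Generators of the odd part `Inder(K)₁`. -/
def InderKSet1 (δ : Z → Z) : Set (Z × Z → Z × Z) :=
  {d | ∃ u v p, KHom p u ∧ KHom (!p) v ∧ d = Dk δ 1 u v}

/-- The odd derivation `η_a` of `K`: `η_a(f) = 0`, `η_a(fx) = fa`. -/
def keta (a : Z) : Z × Z → Z × Z := fun u => (a * u.2, 0)

/-- `kcheck μ a` is the even map `μ̌` of `K` with `μ̌(f) = μ(f)` and
`μ̌(gx) = (μ(g) + ag)x`. -/
def kcheck (μ : Z → Z) (a : Z) : Z × Z → Z × Z := fun u => (μ u.1, μ u.2 + a * u.2)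

/-- The odd map `(aδ)⁻` of `K` (relevant in characteristic 3):
`(aδ)⁻(f) = (aδ(f))x`, `(aδ)⁻(fx) = δ(aδ(f))`. -/
def kminus (δ : Z → Z) (a : Z) : Z × Z → Z × Z := fun u => (δ (a * δ u.2), a * δ u.1)

/-- `D̄er(K) = Der(K)₀ ⊕ {η_a : a ∈ Z}`. -/
def DerbarK (δ : Z → Z) : Set (Z × Z → Z × Z) :=
  {e | ∃ e0 a, IsKDer0 F δ e0 ∧ e = e0 + keta a}

/-- The extension `∂̃` to `J` of the even derivation `∂ = μ̌ = kcheck μ a`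
of `K`: `∂̃|_K = ∂`, `∂̃(fwᵢ) = μ(f)wᵢ`, `∂̃(fxᵢ) = (μ(f) - af)xᵢ`. -/
def jtilde (μ : Z → Z) (a : Z) : J Z → J Z :=
  fun u => (fun k => μ (u.1 k),
    fun k => if k = 0 then μ (u.2 0) + a * u.2 0 else μ (u.2 k) - a * u.2 k)

/-- The odd derivation `η̃_a` of `J`: `η̃_a(Z) = 0`, `η̃_a(x) = a`,
`η̃_a(xⱼ) = 0` (hence `η̃_a(fwᵢ) = -(af)xᵢ`). -/
def jeta (a : Z) : J Z → J Z :=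
  fun u => (fun k => if k = 0 then a * u.2 0 else 0,
            fun k => if k = 0 then 0 else -(a * u.1 k))

/-- The even component of an endomorphism of `J`. -/
def evp (X : J Z → J Z) : J Z → J Z := fun u => (2 : F)⁻¹ • (X u + jsig (X (jsig u)))

/-- The odd component of an endomorphism of `J`. -/
def odp (X : J Z → J Z) : J Z → J Z := fun u => (2 : F)⁻¹ • (X u - jsig (X (jsig u)))

/-- The supercommutator `[X,Y]` in `End_F(J)`. -/
def sbr (X Y : J Z → J Z) : J Z → J Z :=
  X ∘ Y - Y ∘ X + (2 : F) • (odp F Y ∘ odp F X)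

/-- The odd component of an endomorphism of `K`. -/
def kodp (e : Z × Z → Z × Z) : Z × Z → Z × Z :=
  fun u => (2 : F)⁻¹ • (e u - ksig (e (ksig u)))

/-- The supercommutator `[e,e']` in `End_F(K)`. -/
def ksbr (e e' : Z × Z → Z × Z) : Z × Z → Z × Z :=
  e ∘ e' - e' ∘ e + (2 : F) • (kodp F e' ∘ kodp F e)

/-- The automorphism `τ₁ = (12)(34)`: identity on `J^{[0,0]} ⊕ J^{[1,1]}`,
`-1` on `J^{[1,0]} ⊕ J^{[0,1]}`. -/
def tau1Map : J Z → J Z :=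
  fun u => (![u.1 0, -u.1 1, -u.1 2, u.1 3], ![u.2 0, -u.2 1, -u.2 2, u.2 3])

/-- The automorphism `τ₂ = (23)(41)`: identity on `J^{[0,0]} ⊕ J^{[1,0]}`,
`-1` on `J^{[0,1]} ⊕ J^{[1,1]}`. -/
def tau2Map : J Z → J Z :=
  fun u => (![u.1 0, u.1 1, -u.1 2, -u.1 3], ![u.2 0, u.2 1, -u.2 2, -u.2 3])

/-- The automorphism `φ = (123)`: the `Z`-linear map with `φ(vⱼ) = vⱼ₊₁`,
`φ(yⱼ) = yⱼ₊₁` (indices mod 3), `φ(1) = 1`, `φ(y) = y`, where `v₁ = i·w₁`,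
`v₂ = i·w₂`, `v₃ = w₃`, `y = x`, `y₁ = i·x₁`, `y₂ = i·x₂`, `y₃ = x₃`.
In the `w`/`x` coordinates: `w₁ ↦ w₂ ↦ -i·w₃`, `w₃ ↦ i·w₁`,
`x₁ ↦ x₂ ↦ -i·x₃`, `x₃ ↦ i·x₁`. -/
def phiMap (i : F) : J Z → J Z :=
  fun u => (![u.1 0, algebraMap F Z i * u.1 3, u.1 1, -(algebraMap F Z i * u.1 2)],
            ![u.2 0, algebraMap F Z i * u.2 3, u.2 1, -(algebraMap F Z i * u.2 2)])

/-- The automorphism `τ = (12)`: `Z`-linear with `τ(1) = 1`, `τ(y) = y`,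
`τ(v₁) = -v₂`, `τ(v₂) = -v₁`, `τ(v₃) = -v₃`, `τ(y₁) = -y₂`, `τ(y₂) = -y₁`,
`τ(y₃) = -y₃`. -/
def tauMap : J Z → J Z :=
  fun u => (![u.1 0, -u.1 2, -u.1 1, -u.1 3], ![u.2 0, -u.2 2, -u.2 1, -u.2 3])

/-- `g` is an `F`-algebra automorphism of `J = JCK(Z,δ)`. -/
def IsJAut (δ : Z → Z) (g : J Z → J Z) : Prop :=
  IsLin F g ∧ Function.Bijective g ∧ ∀ u v, g (jmul δ u v) = jmul δ (g u) (g v)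

/-- The coordinatization map `Φ : K → Der(J)^{[1,1]}`,
`Φ(f + gy) = D(v₁, f·v₂) + i·D(v₃, g·y)`. -/
def Phi (δ : Z → Z) (i : F) (p : Z × Z) : J Z → J Z :=
  Dgen δ 1 (fw (algebraMap F Z i) 1) (fw (p.1 * algebraMap F Z i) 2) +
    i • Dgen δ 1 (fw (1 : Z) 3) (fx p.2)

/-- `ι₁(z) = φ ∘ Φ(z) ∘ φ⁻¹`, `ι₂(z) = φ² ∘ Φ(z) ∘ φ⁻²`, `ι₃(z) = Φ(z)`
(indexed here by `j = 0, 1, 2` respectively; note `φ⁻¹ = φ²`). -/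
def iot (δ : Z → Z) (i : F) (j : Fin 3) (z : Z × Z) : J Z → J Z :=
  if j = 0 then phiMap F i ∘ Phi F δ i z ∘ (phiMap F i ∘ phiMap F i)
  else if j = 1 then (phiMap F i ∘ phiMap F i) ∘ Phi F δ i z ∘ phiMap F i
  else Phi F δ i z

/-- The embedding `K = Z ⊕ Zx ⊆ J`. -/
def kap : Z × Z → J Z :=
  fun p => (fun j => if j = 0 then p.1 else 0, fun j => if j = 0 then p.2 else 0)

/-- The projection `J → K` onto the `Z ⊕ Zx` coordinates. -/
def pik : J Z → Z × Z := fun u => (u.1 0, u.2 0)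

end CKJ

open CKJ

namespace CKJ

theorem fin4_funext {Z : Type*} {a b : Fin 4 → Z} (h0 : a 0 = b 0) (h1 : a 1 = b 1)
    (h2 : a 2 = b 2) (h3 : a 3 = b 3) : a = b := by
  funext k
  fin_cases k <;> assumption

section

variable {F : Type*} [Field F] {Z : Type*} [CommRing Z] [Algebra F Z] (δ : Derivation F Z Z)

theorem eq_zero_of_two_mul (h2 : (2 : F) ≠ 0) {z : Z} (h : 2 * z = 0) : z = 0 := by
  have h' : (2 : F) • z = 0 := by rw [Algebra.smul_def, map_ofNat, h]
  exact (smul_eq_zero_iff_right h2).1 h'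

theorem eq_zero_of_mul_derivation
    (hspan : Submodule.span F {z : Z | ∃ f g : Z, z = f * δ g} = ⊤) {c : Z}
    (h : ∀ g, c * δ g = 0) : c = 0 := by
  have key : ∀ z ∈ Submodule.span F {z : Z | ∃ f g : Z, z = f * δ g}, c * z = 0 := by
    intro z hz
    induction hz using Submodule.span_induction with
    | mem z hz =>
      obtain ⟨f, g, rfl⟩ := hz
      rw [mul_left_comm, h, mul_zero]
    | zero => rw [mul_zero]
    | add y z _ _ hy hz => rw [mul_add, hy, hz, add_zero]
    | smul r z _ hz => rw [mul_smul_comm, hz, smul_zero]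
  simpa using key 1 (hspan ▸ Submodule.mem_top)

theorem J_decomp (u : J Z) :
    u = fw (u.1 0) 0 + fw (u.1 1) 1 + fw (u.1 2) 2 + fw (u.1 3) 3 +
      (fxi (u.2 0) 0 + fxi (u.2 1) 1 + fxi (u.2 2) 2 + fxi (u.2 3) 3) := by
  refine Prod.ext (fin4_funext ?_ ?_ ?_ ?_) (fin4_funext ?_ ?_ ?_ ?_) <;> simp [fw, fxi]

theorem IsLin.eq_of_forall {d e : J Z → J Z} (hd : IsLin F d) (he : IsLin F e)
    (hw : ∀ f k, d (fw f k) = e (fw f k)) (hx : ∀ f k, d (fxi f k) = e (fxi f k)) : d = e := by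
  funext u
  rw [J_decomp u]
  simp only [hd.1, he.1, hw, hx]

set_option maxHeartbeats 2000000 in
/-- The multiplication of `JCK(Z,δ)` as a bilinear map. -/
def jmulLin : J Z →ₗ[F] J Z →ₗ[F] J Z :=
  LinearMap.mk₂ F (jmul δ)
    (fun u v w => by
      refine Prod.ext (fin4_funext ?_ ?_ ?_ ?_) (fin4_funext ?_ ?_ ?_ ?_) <;>
        simp [jmul, emul, omul, eomul] <;> ring)
    (fun c u v => by
      refine Prod.ext (fin4_funext ?_ ?_ ?_ ?_) (fin4_funext ?_ ?_ ?_ ?_) <;>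
        simp [jmul, emul, omul, eomul, smul_add, smul_sub])
    (fun u v w => by
      refine Prod.ext (fin4_funext ?_ ?_ ?_ ?_) (fin4_funext ?_ ?_ ?_ ?_) <;>
        simp [jmul, emul, omul, eomul] <;> ring)
    (fun c u v => by
      refine Prod.ext (fin4_funext ?_ ?_ ?_ ?_) (fin4_funext ?_ ?_ ?_ ?_) <;>
        simp [jmul, emul, omul, eomul, smul_add, smul_sub])

theorem jmul_sub_left (u v w : J Z) : jmul δ (u - v) w = jmul δ u w - jmul δ v w :=
  (jmulLin δ).map_sub₂ u v w

theorem jmul_sub_right (u v w : J Z) : jmul δ w (u - v) = jmul δ w u - jmul δ w v :=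
  (jmulLin δ w).map_sub u v

theorem jmul_zero_left (u : J Z) : jmul δ 0 u = 0 :=
  (jmulLin δ).map_zero₂ u

theorem jmul_zero_right (u : J Z) : jmul δ u 0 = 0 :=
  (jmulLin δ u).map_zero

/-- The map `v ↦ u(v·) - ε v(u·)` as a linear map. -/
def DgenLin (ε : ℤ) (u : J Z) : J Z →ₗ[F] J Z → J Z where
  toFun v := Dgen δ ε u v
  map_add' v w := by
    funext c
    change jmulLin δ u (jmulLin δ (v + w) c) - ε • jmulLin δ (v + w) (jmulLin δ u c) =
      (jmulLin δ u (jmulLin δ v c) - ε • jmulLin δ v (jmulLin δ u c)) +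
      (jmulLin δ u (jmulLin δ w c) - ε • jmulLin δ w (jmulLin δ u c))
    simp only [map_add, LinearMap.add_apply, smul_add]
    abel
  map_smul' r v := by
    funext c
    change jmulLin δ u (jmulLin δ (r • v) c) - ε • jmulLin δ (r • v) (jmulLin δ u c) =
      r • (jmulLin δ u (jmulLin δ v c) - ε • jmulLin δ v (jmulLin δ u c))
    simp only [map_smul, LinearMap.smul_apply, smul_sub, smul_comm ε r]

theorem isLin_Dgen (ε : ℤ) (u v : J Z) : IsLin F (Dgen δ ε u v) := by
  refine ⟨fun c e => ?_, fun r c => ?_⟩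
  · change jmulLin δ u (jmulLin δ v (c + e)) - ε • jmulLin δ v (jmulLin δ u (c + e)) =
      (jmulLin δ u (jmulLin δ v c) - ε • jmulLin δ v (jmulLin δ u c)) +
      (jmulLin δ u (jmulLin δ v e) - ε • jmulLin δ v (jmulLin δ u e))
    simp only [map_add, smul_add]
    abel
  · change jmulLin δ u (jmulLin δ v (r • c)) - ε • jmulLin δ v (jmulLin δ u (r • c)) =
      r • (jmulLin δ u (jmulLin δ v c) - ε • jmulLin δ v (jmulLin δ u c))
    simp only [map_smul, smul_sub, smul_comm ε r]

/-- `f ↦ f·wₖ` as a linear map. -/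
def fwLin (k : Fin 4) : Z →ₗ[F] J Z where
  toFun f := fw f k
  map_add' f g := by
    refine Prod.ext (funext fun l => ?_) (by simp [fw])
    by_cases h : l = k <;> simp [fw, h]
  map_smul' c f := by
    refine Prod.ext (funext fun l => ?_) (by simp [fw])
    by_cases h : l = k <;> simp [fw, h]

/-- `f ↦ f·xₖ` as a linear map. -/
def fxiLin (k : Fin 4) : Z →ₗ[F] J Z where
  toFun f := fxi f k
  map_add' f g := by
    refine Prod.ext (by simp [fxi]) (funext fun l => ?_)
    by_cases h : l = k <;> simp [fxi, h]
  map_smul' c f := by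
    refine Prod.ext (by simp [fxi]) (funext fun l => ?_)
    by_cases h : l = k <;> simp [fxi, h]

theorem IsDer0.sub {d e : J Z → J Z} (hd : IsDer0 F δ d) (he : IsDer0 F δ e) :
    IsDer0 F δ (fun u => d u - e u) := by
  refine ⟨⟨fun u v => ?_, fun c u => ?_⟩, fun u hu => ?_, fun u hu => ?_, fun u v => ?_⟩
  · simp only [hd.1.1, he.1.1]; abel
  · simp only [hd.1.2, he.1.2, smul_sub]
  · simp [hd.2.1 u hu, he.2.1 u hu]
  · simp [hd.2.2.1 u hu, he.2.2.1 u hu]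
  · simp only [hd.2.2.2, he.2.2.2, jmul_sub_left, jmul_sub_right]; abel

theorem DerDeg.sub {t : ZMod 2 × ZMod 2} {d e : J Z → J Z} (hd : DerDeg t d) (he : DerDeg t e) :
    DerDeg t (fun u => d u - e u) := by
  intro s u hu k hk
  simp [hd s u hu k hk, he s u hu k hk]

/-- The square of `wₖ`. -/
def wSq (Z : Type*) [CommRing Z] (k : Fin 4) : Z := if k = 3 then -1 else 1

theorem wSq_mul_self (k : Fin 4) : wSq Z k * wSq Z k = 1 := by
  unfold wSq; split_ifs <;> ring

theorem jmul_fw_zero_fw (f g : Z) (k : Fin 4) : jmul δ (fw f 0) (fw g k) = fw (f * g) k := by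
  refine Prod.ext (fin4_funext ?_ ?_ ?_ ?_) (fin4_funext ?_ ?_ ?_ ?_) <;> fin_cases k <;>
    simp [jmul, emul, omul, eomul, fw]

theorem jmul_fw_zero_fxi (f g : Z) (k : Fin 4) : jmul δ (fw f 0) (fxi g k) = fxi (f * g) k := by
  refine Prod.ext (fin4_funext ?_ ?_ ?_ ?_) (fin4_funext ?_ ?_ ?_ ?_) <;> fin_cases k <;>
    simp [jmul, emul, omul, eomul, fw, fxi]

theorem jmul_fw_self (f g : Z) (k : Fin 4) :
    jmul δ (fw f k) (fw g k) = fw (wSq Z k * (f * g)) 0 := by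
  refine Prod.ext (fin4_funext ?_ ?_ ?_ ?_) (fin4_funext ?_ ?_ ?_ ?_) <;> fin_cases k <;>
    simp [jmul, emul, omul, eomul, fw, wSq]

theorem jmul_fw_ne (f g : Z) {k l : Fin 4} (hk : k ≠ 0) (hl : l ≠ 0) (h : k ≠ l) :
    jmul δ (fw f k) (fw g l) = 0 := by
  refine Prod.ext (fin4_funext ?_ ?_ ?_ ?_) (fin4_funext ?_ ?_ ?_ ?_) <;> fin_cases k <;>
    fin_cases l <;> simp [jmul, emul, omul, eomul, fw] at *

theorem jmul_fw_fx (f g : Z) {k : Fin 4} (hk : k ≠ 0) :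
    jmul δ (fw f k) (fxi g 0) = fxi (δ f * g) k := by
  refine Prod.ext (fin4_funext ?_ ?_ ?_ ?_) (fin4_funext ?_ ?_ ?_ ?_) <;> fin_cases k <;>
    simp [jmul, emul, omul, eomul, fw, fxi] at *

theorem jmul_fxi_fx (f g : Z) {k : Fin 4} (hk : k ≠ 0) :
    jmul δ (fxi f k) (fxi g 0) = fw (f * g) k := by
  refine Prod.ext (fin4_funext ?_ ?_ ?_ ?_) (fin4_funext ?_ ?_ ?_ ?_) <;> fin_cases k <;>
    simp [jmul, emul, omul, eomul, fw, fxi] at *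

theorem jmul_fx_fx (f g : Z) :
    jmul δ (fxi f 0) (fxi g 0) = fw (δ f * g - f * δ g) 0 := by
  refine Prod.ext (fin4_funext ?_ ?_ ?_ ?_) (fin4_funext ?_ ?_ ?_ ?_) <;>
    simp [jmul, emul, omul, eomul, fw, fxi]

theorem jmul_fxi_fxi (f g : Z) {k l : Fin 4} (hk : k ≠ 0) (hl : l ≠ 0) :
    jmul δ (fxi f k) (fxi g l) = 0 := by
  refine Prod.ext (fin4_funext ?_ ?_ ?_ ?_) (fin4_funext ?_ ?_ ?_ ?_) <;> fin_cases k <;>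
    fin_cases l <;> simp [jmul, emul, omul, eomul, fxi] at *

theorem jmul_fw_fw_zero (f g : Z) (k : Fin 4) : jmul δ (fw g k) (fw f 0) = fw (f * g) k := by
  refine Prod.ext (fin4_funext ?_ ?_ ?_ ?_) (fin4_funext ?_ ?_ ?_ ?_) <;> fin_cases k <;>
    simp [jmul, emul, omul, eomul, fw, mul_comm]

theorem exists_jmul_fw_fxi (f g : Z) {i k j : Fin 4} (hi : i ≠ 0) (hk : k ≠ 0) (hj : j ≠ 0)
    (hik : i ≠ k) (hij : i ≠ j) (hkj : k ≠ j) :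
    ∃ c : Z, c * c = 1 ∧ jmul δ (fw f i) (fxi g k) = fxi (c * (f * g)) j := by
  have key : ∀ i k j : Fin 4, (i ≠ 0 ∧ k ≠ 0 ∧ j ≠ 0) ∧ i ≠ k ∧ i ≠ j ∧ k ≠ j →
      (i = 2 ∧ k = 1 ∧ j = 3 ∨ i = 3 ∧ k = 1 ∧ j = 2 ∨ i = 2 ∧ k = 3 ∧ j = 1) ∨
      (i = 1 ∧ k = 2 ∧ j = 3 ∨ i = 1 ∧ k = 3 ∧ j = 2 ∨ i = 3 ∧ k = 2 ∧ j = 1) := by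
    decide
  have cases := key i k j ⟨⟨hi, hk, hj⟩, hik, hij, hkj⟩
  rcases cases with h | h
  · refine ⟨1, by ring, ?_⟩
    rcases h with ⟨rfl, rfl, rfl⟩ | ⟨rfl, rfl, rfl⟩ | ⟨rfl, rfl, rfl⟩ <;>
      refine Prod.ext (fin4_funext ?_ ?_ ?_ ?_) (fin4_funext ?_ ?_ ?_ ?_) <;>
      simp [jmul, emul, omul, eomul, fw, fxi]
  · refine ⟨-1, by ring, ?_⟩
    rcases h with ⟨rfl, rfl, rfl⟩ | ⟨rfl, rfl, rfl⟩ | ⟨rfl, rfl, rfl⟩ <;>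
      refine Prod.ext (fin4_funext ?_ ?_ ?_ ?_) (fin4_funext ?_ ?_ ?_ ?_) <;>
      simp [jmul, emul, omul, eomul, fw, fxi]

theorem fw_add (f g : Z) (k : Fin 4) : fw f k + fw g k = fw (f + g) k := by
  refine Prod.ext (funext fun l => ?_) (by simp [fw])
  by_cases h : l = k <;> simp [fw, h]

theorem fw_zero (k : Fin 4) : fw (0 : Z) k = 0 := by
  simp [fw, Prod.ext_iff, funext_iff]

theorem fxi_zero (k : Fin 4) : fxi (0 : Z) k = 0 := by
  simp [fxi, Prod.ext_iff, funext_iff]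

theorem fw_inj {f g : Z} {k : Fin 4} (h : fw f k = fw g k) : f = g := by
  simpa [fw] using congrFun (congrArg Prod.fst h) k

theorem fxi_inj {f g : Z} {k : Fin 4} (h : fxi f k = fxi g k) : f = g := by
  simpa [fxi] using congrFun (congrArg Prod.snd h) k

theorem IsLin.map_zero {d : J Z → J Z} (hd : IsLin F d) : d 0 = 0 := by
  simpa using hd.2 0 0

theorem fw_mem_gset (f : Z) (s : ZMod 2 × ZMod 2) : fw f (idx s) ∈ gset (Z := Z) s := by
  intro k hk; simp [fw, hk]

theorem fxi_mem_gset (f : Z) (s : ZMod 2 × ZMod 2) : fxi f (idx s) ∈ gset (Z := Z) s := by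
  intro k hk; simp [fxi, hk]

variable {δ} in
theorem IsDer0.exists_fw {t : ZMod 2 × ZMod 2} {d : J Z → J Z} (hd : IsDer0 F δ d)
    (ht : DerDeg t d) (s : ZMod 2 × ZMod 2) (f : Z) :
    ∃ g, d (fw f (idx s)) = fw g (idx (s + t)) := by
  refine ⟨(d (fw f (idx s))).1 (idx (s + t)), Prod.ext (funext fun k => ?_) ?_⟩
  · by_cases hk : k = idx (s + t)
    · simp [fw, hk]
    · rw [(ht s _ (fw_mem_gset f s) k hk).1]; simp [fw, hk]
  · rw [hd.2.1 _ rfl]; rfl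

variable {δ} in
theorem IsDer0.exists_fxi {t : ZMod 2 × ZMod 2} {d : J Z → J Z} (hd : IsDer0 F δ d)
    (ht : DerDeg t d) (s : ZMod 2 × ZMod 2) (f : Z) :
    ∃ g, d (fxi f (idx s)) = fxi g (idx (s + t)) := by
  refine ⟨(d (fxi f (idx s))).2 (idx (s + t)), Prod.ext ?_ (funext fun k => ?_)⟩
  · rw [hd.2.2.1 _ rfl]; rfl
  · by_cases hk : k = idx (s + t)
    · simp [fxi, hk]
    · rw [(ht s _ (fxi_mem_gset f s) k hk).2]; simp [fxi, hk]

/-- An even derivation exchanging the sectors `0 ↔ k` and `i ↔ j` (with `{i, j, k} = {1, 2, 3}`)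
vanishes as soon as it kills `wⱼ`. -/
theorem IsDer0.eq_zero_of_apply_w (h2 : (2 : F) ≠ 0)
    (hspan : Submodule.span F {z : Z | ∃ f g : Z, z = f * δ g} = ⊤)
    {t a b : ZMod 2 × ZMod 2} (ht0 : t ≠ 0) (ha0 : a ≠ 0) (hb0 : b ≠ 0)
    (hat : a + t = b) {d : J Z → J Z} (hd : IsDer0 F δ d)
    (ht : DerDeg t d) (hw : d (fw 1 (idx b)) = 0) : ∀ u, d u = 0 := by
  have hbt : b + t = a := by
    rw [← hat, add_assoc, show t + t = 0 by clear! a b d; revert t; decide, add_zero]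
  have htt : t + t = 0 := by clear! a b d; revert t; decide
  have i0 : ∀ s : ZMod 2 × ZMod 2, s ≠ 0 → idx s ≠ 0 := by decide
  have iinj : ∀ s s' : ZMod 2 × ZMod 2, s ≠ s' → idx s ≠ idx s' := by decide
  have hab : a ≠ b := by rintro rfl; exact ht0 (by simpa using hat)
  have hbt' : t ≠ b := by rintro rfl; exact ha0 (by simpa using hat)
  have hi := i0 a ha0
  have hj := i0 b hb0
  have hk := i0 t ht0
  have hjk := iinj t b hbt'
  have hij := iinj a b hab
  have hik := iinj a t (by rintro rfl; exact hb0 (by rw [← hat, htt]))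
  have W := hd.exists_fw ht
  have X := hd.exists_fxi ht
  have D := hd.2.2.2
  have hwj : ∀ f, d (fw f (idx b)) = 0 := by
    intro f
    obtain ⟨g, hg⟩ := W 0 f
    have := D (fw f 0) (fw 1 (idx b))
    rw [jmul_fw_zero_fw, hw, jmul_zero_right, show (0 : Fin 4) = idx 0 from rfl, hg, zero_add,
      jmul_fw_ne δ _ _ hk hj hjk, mul_one, add_zero] at this
    exact this
  have hZ : ∀ f, d (fw f 0) = 0 := by
    intro f
    have := D (fw (wSq Z (idx b) * f) (idx b)) (fw 1 (idx b))
    rw [jmul_fw_self, hwj, hwj, jmul_zero_right, jmul_zero_left, mul_one, ← mul_assoc,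
      wSq_mul_self, one_mul, add_zero] at this
    exact this
  have linW : ∀ k, d (fw 1 k) = 0 → ∀ f, d (fw f k) = 0 := by
    intro k h f
    have := D (fw f 0) (fw 1 k)
    rwa [jmul_fw_zero_fw, h, hZ, jmul_zero_right, jmul_zero_left, mul_one, add_zero] at this
  have linX : ∀ k, d (fxi 1 k) = 0 → ∀ f, d (fxi f k) = 0 := by
    intro k h f
    have := D (fw f 0) (fxi 1 k)
    rwa [jmul_fw_zero_fxi, h, hZ, jmul_zero_right, jmul_zero_left, mul_one, add_zero] at this
  have hwi : ∀ f, d (fw f (idx a)) = 0 := by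
    refine linW _ ?_
    obtain ⟨g, hg⟩ := W a 1
    have := D (fw 1 (idx a)) (fw (wSq Z (idx b)) (idx b))
    rw [jmul_fw_ne δ _ _ hi hj hij, hd.1.map_zero, hwj, jmul_zero_right, hg, hat, jmul_fw_self,
      add_zero, mul_left_comm, wSq_mul_self, mul_one, ← fw_zero 0] at this
    rw [hg, ← fw_inj this, fw_zero]
  have hwk : ∀ f, d (fw f (idx t)) = 0 := by
    refine linW _ ?_
    obtain ⟨g, hg⟩ := W t 1
    have := D (fw 1 (idx t)) (fw 1 (idx t))
    rw [jmul_fw_self, hZ, hg, htt, show idx 0 = 0 from rfl, jmul_fw_zero_fw,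
      jmul_fw_fw_zero, fw_add, mul_one, ← two_mul, ← fw_zero (idx t)] at this
    rw [hg, eq_zero_of_two_mul h2 (fw_inj this).symm, fw_zero]
  have hxi : ∀ f, d (fxi f (idx a)) = 0 := by
    refine linX _ ?_
    obtain ⟨g, hg⟩ := X a 1
    obtain ⟨g', hg'⟩ := X 0 1
    have := D (fxi 1 (idx a)) (fxi 1 0)
    rw [jmul_fxi_fx δ _ _ hi, hwi, hg, show (0 : Fin 4) = idx 0 from rfl, hg', zero_add, hat,
      jmul_fxi_fxi δ _ _ hi hk, show idx 0 = 0 from rfl, jmul_fxi_fx δ _ _ hj, add_zero, mul_one,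
      ← fw_zero (idx b)] at this
    rw [hg, hat, ← fw_inj this, fxi_zero]
  have hxj : ∀ f, d (fxi f (idx b)) = 0 := by
    refine linX _ ?_
    obtain ⟨g, hg⟩ := X b 1
    obtain ⟨g', hg'⟩ := X 0 1
    have := D (fxi 1 (idx b)) (fxi 1 0)
    rw [jmul_fxi_fx δ _ _ hj, hwj, hg, show (0 : Fin 4) = idx 0 from rfl, hg', zero_add, hbt,
      jmul_fxi_fxi δ _ _ hj hk, show idx 0 = 0 from rfl, jmul_fxi_fx δ _ _ hi, add_zero, mul_one,
      ← fw_zero (idx a)] at this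
    rw [hg, hbt, ← fw_inj this, fxi_zero]
  have hx : ∀ f, d (fxi f 0) = 0 := by
    refine linX _ ?_
    obtain ⟨g, hg⟩ := X 0 1
    obtain ⟨c, hc, hcg⟩ := exists_jmul_fw_fxi δ 1 g hi hk hj hik hij hjk
    have := D (fw 1 (idx a)) (fxi 1 0)
    rw [jmul_fw_fx δ _ _ hi, hxi, hwi, jmul_zero_left, zero_add, show (0 : Fin 4) = idx 0 from rfl,
      hg, zero_add, hcg, one_mul, ← fxi_zero (idx b)] at this
    have h0 : g = 0 := by
      rw [← one_mul g, ← hc, mul_assoc, ← fxi_inj this, mul_zero]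
    rw [show (0 : Fin 4) = idx 0 from rfl, hg, h0, fxi_zero]
  have hxk : ∀ f, d (fxi f (idx t)) = 0 := by
    refine linX _ ?_
    obtain ⟨g, hg⟩ := X t 1
    have key : ∀ h, δ g * h - g * δ h = 0 := by
      intro h
      have := D (fxi 1 (idx t)) (fxi h 0)
      rw [jmul_fxi_fx δ _ _ hk, hwk, hg, hx, htt, show idx 0 = 0 from rfl, jmul_fx_fx,
        jmul_zero_right, add_zero, ← fw_zero 0] at this
      exact (fw_inj this).symm
    have h1 : δ g = 0 := by simpa using key 1
    have h0 : g = 0 := eq_zero_of_mul_derivation δ hspan fun h => by simpa [h1] using key h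
    rw [hg, h0, fxi_zero]
  have cov : ∀ k, k = 0 ∨ k = idx a ∨ k = idx b ∨ k = idx t := by
    generalize idx a = i, idx b = j, idx t = k at hi hj hk hik hij hjk
    omega
  have hz : IsLin F (fun _ : J Z => (0 : J Z)) := ⟨by simp, by simp⟩
  refine congrFun (hd.1.eq_of_forall hz (fun f k => ?_) fun f k => ?_)
  · rcases cov k with rfl | rfl | rfl | rfl <;> simp only [*]
  · rcases cov k with rfl | rfl | rfl | rfl <;> simp only [*]

theorem Dgen_w_two_w_three_apply (f : Z) (u : J Z) :
    Dgen δ 1 (fw 1 2) (fw f 3) u = (![0, 0, -(f * u.1 3), -(f * u.1 2)],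
      ![0, δ f * u.2 0, -(f * u.2 3), -(f * u.2 2)]) := by
  refine Prod.ext (fin4_funext ?_ ?_ ?_ ?_) (fin4_funext ?_ ?_ ?_ ?_) <;>
    simp [Dgen, jmul, emul, omul, eomul, fw]

theorem isDer0_Dgen_w_two_w_three (f : Z) : IsDer0 F δ (Dgen δ 1 (fw 1 2) (fw f 3)) := by
  refine ⟨isLin_Dgen δ _ _ _, fun u hu => ?_, fun u hu => ?_, fun u v => ?_⟩
  · rw [Dgen_w_two_w_three_apply]
    refine fin4_funext ?_ ?_ ?_ ?_ <;> simp [hu]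
  · rw [Dgen_w_two_w_three_apply]
    refine fin4_funext ?_ ?_ ?_ ?_ <;> simp [hu]
  · simp only [Dgen_w_two_w_three_apply]
    refine Prod.ext (fin4_funext ?_ ?_ ?_ ?_) (fin4_funext ?_ ?_ ?_ ?_) <;>
      simp [jmul, emul, omul, eomul] <;> ring

theorem derDeg_Dgen_w_two_w_three (f : Z) : DerDeg (1, 0) (Dgen δ 1 (fw 1 2) (fw f 3)) := by
  intro s u hu k hk
  rw [Dgen_w_two_w_three_apply]
  have cases : (idx s = 0 ∧ idx (s + (1, 0)) = 1) ∨ (idx s = 1 ∧ idx (s + (1, 0)) = 0) ∨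
      (idx s = 2 ∧ idx (s + (1, 0)) = 3) ∨ (idx s = 3 ∧ idx (s + (1, 0)) = 2) := by
    clear hu hk; revert s; decide
  have h0 := hu 0
  have h1 := hu 1
  have h2 := hu 2
  have h3 := hu 3
  clear hu
  rcases cases with ⟨e, e'⟩ | ⟨e, e'⟩ | ⟨e, e'⟩ | ⟨e, e'⟩ <;> rw [e] at h0 h1 h2 h3 <;>
    rw [e'] at hk <;> clear e e' <;> fin_cases k <;> simp_all

theorem Dgen_w_three_w_one_apply (f : Z) (u : J Z) :
    Dgen δ 1 (fw 1 3) (fw f 1) u = (![0, f * u.1 3, 0, f * u.1 1],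
      ![0, f * u.2 3, δ f * u.2 0, f * u.2 1]) := by
  refine Prod.ext (fin4_funext ?_ ?_ ?_ ?_) (fin4_funext ?_ ?_ ?_ ?_) <;>
    simp [Dgen, jmul, emul, omul, eomul, fw]

theorem isDer0_Dgen_w_three_w_one (f : Z) : IsDer0 F δ (Dgen δ 1 (fw 1 3) (fw f 1)) := by
  refine ⟨isLin_Dgen δ _ _ _, fun u hu => ?_, fun u hu => ?_, fun u v => ?_⟩
  · rw [Dgen_w_three_w_one_apply]
    refine fin4_funext ?_ ?_ ?_ ?_ <;> simp [hu]
  · rw [Dgen_w_three_w_one_apply]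
    refine fin4_funext ?_ ?_ ?_ ?_ <;> simp [hu]
  · simp only [Dgen_w_three_w_one_apply]
    refine Prod.ext (fin4_funext ?_ ?_ ?_ ?_) (fin4_funext ?_ ?_ ?_ ?_) <;>
      simp [jmul, emul, omul, eomul] <;> ring

theorem derDeg_Dgen_w_three_w_one (f : Z) : DerDeg (0, 1) (Dgen δ 1 (fw 1 3) (fw f 1)) := by
  intro s u hu k hk
  rw [Dgen_w_three_w_one_apply]
  have cases : (idx s = 0 ∧ idx (s + (0, 1)) = 2) ∨ (idx s = 1 ∧ idx (s + (0, 1)) = 3) ∨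
      (idx s = 2 ∧ idx (s + (0, 1)) = 0) ∨ (idx s = 3 ∧ idx (s + (0, 1)) = 1) := by
    clear hu hk; revert s; decide
  have h0 := hu 0
  have h1 := hu 1
  have h2 := hu 2
  have h3 := hu 3
  clear hu
  rcases cases with ⟨e, e'⟩ | ⟨e, e'⟩ | ⟨e, e'⟩ | ⟨e, e'⟩ <;> rw [e] at h0 h1 h2 h3 <;>
    rw [e'] at hk <;> clear e e' <;> fin_cases k <;> simp_all

theorem Dgen_w_one_w_two_apply (f : Z) (u : J Z) :
    Dgen δ 1 (fw 1 1) (fw f 2) u = (![0, f * u.1 2, -(f * u.1 1), 0],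
      ![0, f * u.2 2, -(f * u.2 1), -(δ f * u.2 0)]) := by
  refine Prod.ext (fin4_funext ?_ ?_ ?_ ?_) (fin4_funext ?_ ?_ ?_ ?_) <;>
    simp [Dgen, jmul, emul, omul, eomul, fw]

theorem isDer0_Dgen_w_one_w_two (f : Z) : IsDer0 F δ (Dgen δ 1 (fw 1 1) (fw f 2)) := by
  refine ⟨isLin_Dgen δ _ _ _, fun u hu => ?_, fun u hu => ?_, fun u v => ?_⟩
  · rw [Dgen_w_one_w_two_apply]
    refine fin4_funext ?_ ?_ ?_ ?_ <;> simp [hu]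
  · rw [Dgen_w_one_w_two_apply]
    refine fin4_funext ?_ ?_ ?_ ?_ <;> simp [hu]
  · simp only [Dgen_w_one_w_two_apply]
    refine Prod.ext (fin4_funext ?_ ?_ ?_ ?_) (fin4_funext ?_ ?_ ?_ ?_) <;>
      simp [jmul, emul, omul, eomul] <;> ring

theorem derDeg_Dgen_w_one_w_two (f : Z) : DerDeg (1, 1) (Dgen δ 1 (fw 1 1) (fw f 2)) := by
  intro s u hu k hk
  rw [Dgen_w_one_w_two_apply]
  have cases : (idx s = 0 ∧ idx (s + (1, 1)) = 3) ∨ (idx s = 1 ∧ idx (s + (1, 1)) = 2) ∨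
      (idx s = 2 ∧ idx (s + (1, 1)) = 1) ∨ (idx s = 3 ∧ idx (s + (1, 1)) = 0) := by
    clear hu hk; revert s; decide
  have h0 := hu 0
  have h1 := hu 1
  have h2 := hu 2
  have h3 := hu 3
  clear hu
  rcases cases with ⟨e, e'⟩ | ⟨e, e'⟩ | ⟨e, e'⟩ | ⟨e, e'⟩ <;> rw [e] at h0 h1 h2 h3 <;>
    rw [e'] at hk <;> clear e e' <;> fin_cases k <;> simp_all

theorem span_range_coe {M N : Type*} [AddCommGroup M] [Module F M] [AddCommGroup N] [Module F N]
    (φ : M →ₗ[F] N) : (Submodule.span F {d | ∃ f, d = φ f} : Set N) = {d | ∃ f, d = φ f} := by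
  have : {d | ∃ f, d = φ f} = (LinearMap.range φ : Set N) := by
    ext d; simp [eq_comm]
  rw [this, Submodule.span_eq]

/-- If the maps `D(wᵢ, f·wⱼ)` are even derivations of a given degree and send `wⱼ` to `wⱼ² f·wᵢ`,
then they exhaust the even derivations of their degree. -/
theorem setOf_isDer0_eq_span (h2 : (2 : F) ≠ 0)
    (hspan : Submodule.span F {z : Z | ∃ f g : Z, z = f * δ g} = ⊤)
    {t a b : ZMod 2 × ZMod 2} (ht0 : t ≠ 0) (ha0 : a ≠ 0) (hb0 : b ≠ 0) (hat : a + t = b)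
    (hbt : b + t = a)
    (hD : ∀ f : Z, IsDer0 F δ (Dgen δ 1 (fw 1 (idx a)) (fw f (idx b))))
    (hdeg : ∀ f : Z, DerDeg t (Dgen δ 1 (fw (1 : Z) (idx a)) (fw f (idx b))))
    (hv : ∀ f : Z, Dgen δ 1 (fw 1 (idx a)) (fw f (idx b)) (fw 1 (idx b)) =
      fw (wSq Z (idx b) * f) (idx a)) :
    {d : J Z → J Z | IsDer0 F δ d ∧ DerDeg t d} =
      (Submodule.span F {d : J Z → J Z | ∃ f : Z,
        d = Dgen δ 1 (fw (1 : Z) (idx a)) (fw f (idx b))} : Set (J Z → J Z)) := by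
  refine Eq.trans ?_
    (span_range_coe (DgenLin (F := F) δ 1 (fw (1 : Z) (idx a)) ∘ₗ fwLin (idx b))).symm
  ext d
  constructor
  · rintro ⟨hd, ht⟩
    obtain ⟨g, hg⟩ := hd.exists_fw ht b 1
    refine ⟨wSq Z (idx b) * g, funext fun u => sub_eq_zero.1 ?_⟩
    refine (hd.sub δ (hD (wSq Z (idx b) * g))).eq_zero_of_apply_w δ h2 hspan ht0 ha0 hb0 hat
      (ht.sub (hdeg _)) ?_ u
    rw [hg, hv, ← mul_assoc, wSq_mul_self, one_mul, hbt, sub_self]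
  · rintro ⟨f, rfl⟩
    exact ⟨hD f, hdeg f⟩

variable {δ} in
theorem isKDer0_kcheck_iff {μ : Z → Z} {a : Z} :
    IsKDer0 F δ (kcheck μ a) ↔
      ∃ D : Derivation F Z Z, ⇑D = μ ∧ ∀ f, D (δ f) = δ (D f) + 2 * a * δ f := by
  constructor
  · intro h
    have hadd : ∀ f g, μ (f + g) = μ f + μ g := fun f g => by
      simpa [kcheck] using congrArg Prod.fst (h.1.1 (f, 0) (g, 0))
    have hsmul : ∀ (c : F) f, μ (c • f) = c • μ f := fun c f => by
      simpa [kcheck] using congrArg Prod.fst (h.1.2 c (f, 0))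
    have h0 : μ 0 = 0 := by simpa using hsmul 0 0
    have hmul : ∀ f g, μ (f * g) = f * μ g + g * μ f := fun f g => by
      have := congrArg Prod.fst (h.2.2.2 (f, 0) (g, 0))
      simp [kcheck, kmul, h0] at this
      rw [this]; ring
    let D : Derivation F Z Z := Derivation.mk' { toFun := μ, map_add' := hadd, map_smul' := hsmul }
      fun f g => by simp [hmul]
    have hD : ⇑D = μ := rfl
    refine ⟨D, hD, fun f => ?_⟩
    have := congrArg Prod.fst (h.2.2.2 (0, f) (0, 1))
    rw [← hD] at this
    simp [kcheck, kmul] at this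
    rw [this]; ring
  · rintro ⟨D, rfl, hD⟩
    refine ⟨⟨fun u v => ?_, fun c u => ?_⟩, fun u hu => ?_, fun u hu => ?_, fun u v => ?_⟩
    · refine Prod.ext ?_ ?_ <;> simp [kcheck]; ring
    · refine Prod.ext ?_ ?_ <;> simp [kcheck]
    · simp [kcheck, hu]
    · simp [kcheck, hu]
    · refine Prod.ext ?_ ?_ <;> simp [kcheck, kmul, hD] <;> ring

theorem isDer0_jtilde (D : Derivation F Z Z) (a : Z) (hD : ∀ f, D (δ f) = δ (D f) + 2 * a * δ f) :
    IsDer0 F δ (jtilde D a) := by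
  refine ⟨⟨fun u v => ?_, fun c u => ?_⟩, fun u hu => ?_, fun u hu => ?_, fun u v => ?_⟩
  · refine Prod.ext (fin4_funext ?_ ?_ ?_ ?_) (fin4_funext ?_ ?_ ?_ ?_) <;> simp [jtilde] <;> ring
  · refine Prod.ext (fin4_funext ?_ ?_ ?_ ?_) (fin4_funext ?_ ?_ ?_ ?_) <;>
      simp [jtilde, smul_sub]
  · refine fin4_funext ?_ ?_ ?_ ?_ <;> simp [jtilde, hu]
  · refine fin4_funext ?_ ?_ ?_ ?_ <;> simp [jtilde, hu]
  · refine Prod.ext (fin4_funext ?_ ?_ ?_ ?_) (fin4_funext ?_ ?_ ?_ ?_) <;>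
      simp [jtilde, jmul, emul, omul, eomul, hD] <;> ring

theorem derDeg_jtilde {μ : Z → Z} (h0 : μ 0 = 0) (a : Z) : DerDeg (0, 0) (jtilde μ a) := by
  intro s u hu k hk
  rw [show s + (0, 0) = s from add_zero s] at hk
  have := hu k hk
  refine ⟨by simp [jtilde, this.1, h0], ?_⟩
  by_cases hk0 : k = 0
  · subst hk0
    simp [jtilde, this.2, h0]
  · simp [jtilde, this.2, h0, hk0]

/-- An even derivation of degree `[0,0]` vanishing on `Z` and `x` is zero. -/
theorem IsDer0.eq_zero_of_apply_x (h2 : (2 : F) ≠ 0) {d : J Z → J Z} (hd : IsDer0 F δ d)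
    (ht : DerDeg (0, 0) d) (hZ : ∀ f, d (fw f 0) = 0) (hx : d (fxi 1 0) = 0) : ∀ u, d u = 0 := by
  have W := hd.exists_fw ht
  have X := hd.exists_fxi ht
  have D := hd.2.2.2
  have at0 : ∀ s : ZMod 2 × ZMod 2, s + (0, 0) = s := fun s => add_zero s
  have hidx : ∀ k : Fin 4, ∃ s, idx s = k := by decide
  have hw : ∀ k, d (fw 1 k) = 0 := by
    intro k
    by_cases hk : k = 0
    · rw [hk, hZ]
    obtain ⟨s, rfl⟩ := hidx k
    obtain ⟨g, hg⟩ := W s 1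
    have := D (fw 1 (idx s)) (fw 1 (idx s))
    rw [at0] at hg
    rw [jmul_fw_self, hZ, hg, jmul_fw_self, jmul_fw_self, fw_add, ← mul_add, ← fw_zero 0] at this
    have h0 : 2 * g = 0 := by
      linear_combination (-wSq Z (idx s)) * fw_inj this - 2 * g * wSq_mul_self (Z := Z) (idx s)
    rw [hg, eq_zero_of_two_mul h2 h0, fw_zero]
  have hxi : ∀ k, d (fxi 1 k) = 0 := by
    intro k
    by_cases hk : k = 0
    · rw [hk, hx]
    obtain ⟨s, rfl⟩ := hidx k
    obtain ⟨g, hg⟩ := X s 1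
    have := D (fxi 1 (idx s)) (fxi 1 0)
    rw [at0] at hg
    rw [jmul_fxi_fx δ _ _ hk, mul_one, hw, hg, hx, jmul_zero_right, jmul_fxi_fx δ _ _ hk, add_zero,
      mul_one, ← fw_zero (idx s)] at this
    rw [hg, ← fw_inj this, fxi_zero]
  have hz : IsLin F (fun _ : J Z => (0 : J Z)) := ⟨by simp, by simp⟩
  refine congrFun (hd.1.eq_of_forall hz (fun f k => ?_) fun f k => ?_)
  · have := D (fw f 0) (fw 1 k)
    rwa [jmul_fw_zero_fw, hw, hZ, jmul_zero_right, jmul_zero_left, mul_one, add_zero] at this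
  · have := D (fw f 0) (fxi 1 k)
    rwa [jmul_fw_zero_fxi, hxi, hZ, jmul_zero_right, jmul_zero_left, mul_one, add_zero] at this

theorem kap_kmul (u v : Z × Z) : kap (kmul δ u v) = jmul δ (kap u) (kap v) := by
  refine Prod.ext (fin4_funext ?_ ?_ ?_ ?_) (fin4_funext ?_ ?_ ?_ ?_) <;>
    simp [kap, kmul, jmul, emul, omul, eomul, mul_comm]

theorem pik_jmul_kap (u v : Z × Z) : pik (jmul δ (kap u) (kap v)) = kmul δ u v := by
  rw [← kap_kmul]; rfl

theorem kap_pik {u : J Z} (hu : u ∈ gset (Z := Z) (0, 0)) : kap (pik u) = u := by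
  refine Prod.ext (funext fun k => ?_) (funext fun k => ?_) <;> by_cases hk : k = 0
  · simp [kap, pik, hk]
  · simp [kap, pik, hk, (hu k hk).1]
  · simp [kap, pik, hk]
  · simp [kap, pik, hk, (hu k hk).2]

theorem kap_mem_gset (p : Z × Z) : kap p ∈ gset (Z := Z) (0, 0) := by
  intro k hk
  have hk' : k ≠ 0 := hk
  simp [kap, hk']

variable {δ} in
/-- An even derivation of degree `[0,0]` restricts to a derivation of `K`. -/
theorem IsDer0.restrict {d : J Z → J Z} (hd : IsDer0 F δ d) (ht : DerDeg (0, 0) d) :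
    IsKDer0 F δ (fun p => pik (d (kap p))) := by
  have hk : ∀ p, kap (pik (d (kap p))) = d (kap p) := fun p =>
    kap_pik (ht (0, 0) _ (kap_mem_gset p))
  have kadd : ∀ u v : Z × Z, kap (u + v) = kap u + kap v := fun u v => by
    refine Prod.ext (fin4_funext ?_ ?_ ?_ ?_) (fin4_funext ?_ ?_ ?_ ?_) <;> simp [kap]
  have ksmul : ∀ (c : F) (u : Z × Z), kap (c • u) = c • kap u := fun c u => by
    refine Prod.ext (fin4_funext ?_ ?_ ?_ ?_) (fin4_funext ?_ ?_ ?_ ?_) <;> simp [kap]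
  refine ⟨⟨fun u v => ?_, fun c u => ?_⟩, fun u hu => ?_, fun u hu => ?_, fun u v => ?_⟩
  · simp only [kadd, hd.1.1]; rfl
  · simp only [ksmul, hd.1.2]; rfl
  · refine congrFun (hd.2.1 (kap u) ?_) 0
    funext k; simp [kap, hu]
  · refine congrFun (hd.2.2.1 (kap u) ?_) 0
    funext k; simp [kap, hu]
  · change pik (d (kap (kmul δ u v))) = _
    rw [kap_kmul, hd.2.2.2, ← hk u, ← hk v]
    change pik (jmul δ _ _) + pik (jmul δ _ _) = _
    simp only [pik_jmul_kap]

variable {δ} in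
theorem IsKDer0.eq_kcheck {e : Z × Z → Z × Z} (he : IsKDer0 F δ e) :
    e = kcheck (fun f => (e (f, 0)).1) (e (0, 1)).2 := by
  funext p
  obtain ⟨f, g⟩ := p
  have h0 : ∀ f, (e (f, 0)).2 = 0 := fun f => he.2.1 _ rfl
  have h1 : ∀ g, (e (0, g)).1 = 0 := fun g => he.2.2.1 _ rfl
  have hs : e (f, g) = e (f, 0) + e (0, g) := by rw [← he.1.1]; simp
  have hm := he.2.2.2 (g, 0) (0, 1)
  rw [hs]
  refine Prod.ext (by simp [kcheck, h1]) ?_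
  have hm2 := congrArg Prod.snd hm
  simp [kmul, h0] at hm2
  simp [kcheck, h0, hm2, mul_comm]

theorem setOf_isDer0_zero_zero (h2 : (2 : F) ≠ 0) :
    {d : J Z → J Z | IsDer0 F δ d ∧ DerDeg ((0, 0) : ZMod 2 × ZMod 2) d}
      = {d | ∃ (μ : Z → Z) (a : Z), IsKDer0 F δ (kcheck μ a) ∧ d = jtilde μ a} := by
  ext d
  constructor
  · rintro ⟨hd, ht⟩
    have he := hd.restrict ht
    have hk := he.eq_kcheck
    set μ := fun f => (pik (d (kap (f, 0)))).1 with hμ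
    set a := (pik (d (kap ((0 : Z), (1 : Z))))).2 with ha
    have he' : IsKDer0 F δ (kcheck μ a) := by rw [← hk]; exact he
    refine ⟨μ, a, he', funext fun u => sub_eq_zero.1 ?_⟩
    obtain ⟨D, hDμ, hD⟩ := isKDer0_kcheck_iff.1 he'
    rw [← hDμ]
    refine (hd.sub δ (isDer0_jtilde δ D a hD)).eq_zero_of_apply_x δ h2
      (ht.sub (derDeg_jtilde (map_zero D) a)) (fun f => ?_) ?_ u
    · obtain ⟨g, hg⟩ := hd.exists_fw ht 0 f
      have hg' : d (fw f 0) = fw g 0 := hg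
      have hf : kap (f, 0) = fw f 0 := by
        simp [kap, fw, Prod.ext_iff, funext_iff]
      have hgμ : D f = g := by
        rw [hDμ, hμ]
        simp only [hf, hg']
        simp [pik, fw]
      rw [hg', sub_eq_zero]
      refine Prod.ext (fin4_funext ?_ ?_ ?_ ?_) (fin4_funext ?_ ?_ ?_ ?_) <;>
        simp [jtilde, fw, hgμ]
    · obtain ⟨g, hg⟩ := hd.exists_fxi ht 0 1
      have hg' : d (fxi 1 0) = fxi g 0 := hg
      have hf : kap ((0 : Z), (1 : Z)) = fxi 1 0 := by
        simp [kap, fxi, Prod.ext_iff, funext_iff]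
      have hga : a = g := by
        rw [ha, hf, hg']
        simp [pik, fxi]
      rw [hg', sub_eq_zero]
      refine Prod.ext (fin4_funext ?_ ?_ ?_ ?_) (fin4_funext ?_ ?_ ?_ ?_) <;>
        simp [jtilde, fxi, hga]
  · rintro ⟨μ, a, hK, rfl⟩
    obtain ⟨D, rfl, hD⟩ := isKDer0_kcheck_iff.1 hK
    exact ⟨isDer0_jtilde δ D a hD, derDeg_jtilde (map_zero D) a⟩

theorem Dgen_fx_fx (f : Z) :
    Dgen δ (-1) (fx 1) (fx f) = jtilde (fun h => -2 * f * δ h) (δ f) := by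
  funext u
  refine Prod.ext (fin4_funext ?_ ?_ ?_ ?_) (fin4_funext ?_ ?_ ?_ ?_) <;>
    simp [Dgen, jmul, emul, omul, eomul, fx, fxi, jtilde] <;> ring

theorem span_Dgen_fx_coe :
    (Submodule.span F {d : J Z → J Z | ∃ f : Z, d = Dgen δ (-1) (fx (1 : Z)) (fx f)} :
      Set (J Z → J Z)) = {d | ∃ f : Z, d = Dgen δ (-1) (fx (1 : Z)) (fx f)} :=
  span_range_coe (DgenLin (F := F) δ (-1) (fx (1 : Z)) ∘ₗ fxiLin 0)

theorem setOf_Dgen_fx_eq (h2 : (2 : F) ≠ 0) :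
    {d | ∃ f : Z, d = Dgen δ (-1) (fx (1 : Z)) (fx f)}
      = {d | ∃ a a' : Z, 2 * a' = -δ a ∧ d = jtilde (fun h => a * δ h) a'} := by
  ext d
  constructor
  · rintro ⟨f, rfl⟩
    refine ⟨-2 * f, δ f, ?_, Dgen_fx_fx δ f⟩
    rw [neg_mul, map_neg, two_mul, two_mul, map_add, neg_neg]
  · rintro ⟨a, a', ha, rfl⟩
    have half : (2 : Z) * ((2 : F)⁻¹ • a) = a := by
      rw [two_mul, ← two_smul F, smul_inv_smul₀ h2]
    refine ⟨-((2 : F)⁻¹ • a), ?_⟩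
    have h1 : -2 * -((2 : F)⁻¹ • a) = a := by rw [neg_mul_neg, half]
    have hδ : δ (-((2 : F)⁻¹ • a)) = a' := by
      refine (sub_eq_zero.1 (eq_zero_of_two_mul h2 ?_)).symm
      rw [mul_sub, ha, two_mul, ← map_add, ← neg_add, ← two_mul, half, map_neg, sub_self]
    rw [Dgen_fx_fx, h1, hδ]

set_option maxHeartbeats 2000000 in
/-- The diagonal part of `D(u,v)` with `u`, `v` of the same parity agrees with that of
`D(x, fx)`, where `f` is the product of the `x`-coordinates of `u` and `v`. -/
theorem Dgen_diagonal {u v : J Z} {p : Bool} (hu : IsHom p u) (hv : IsHom p v) (h : Z)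
    (k : Fin 4) :
    ((Dgen δ (sgn p p) u v (fw h k)).1 k =
        (jtilde (fun h => -2 * (u.2 0 * v.2 0) * δ h) (δ (u.2 0 * v.2 0)) (fw h k)).1 k ∧
      (Dgen δ (sgn p p) u v (fw h k)).2 = 0) ∧
    ((Dgen δ (sgn p p) u v (fxi h k)).2 k =
        (jtilde (fun h => -2 * (u.2 0 * v.2 0) * δ h) (δ (u.2 0 * v.2 0)) (fxi h k)).2 k ∧
      (Dgen δ (sgn p p) u v (fxi h k)).1 = 0) := by
  obtain ⟨u1, u2⟩ := u
  obtain ⟨v1, v2⟩ := v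
  cases p
  · obtain rfl : u2 = 0 := hu
    obtain rfl : v2 = 0 := hv
    refine ⟨⟨?_, fin4_funext ?_ ?_ ?_ ?_⟩, ?_, fin4_funext ?_ ?_ ?_ ?_⟩ <;> fin_cases k <;>
      simp [Dgen, sgn, jmul, emul, omul, eomul, fw, fxi, jtilde] <;> ring
  · obtain rfl : u1 = 0 := hu
    obtain rfl : v1 = 0 := hv
    refine ⟨⟨?_, fin4_funext ?_ ?_ ?_ ?_⟩, ?_, fin4_funext ?_ ?_ ?_ ?_⟩ <;> fin_cases k <;>
      simp [Dgen, sgn, jmul, emul, omul, eomul, fw, fxi, jtilde] <;> ring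

theorem exists_diagonal_of_mem_span {d : J Z → J Z} (hd : d ∈ Submodule.span F (InderSet0 δ)) :
    IsLin F d ∧ ∃ f : Z, ∀ h k,
      ((d (fw h k)).1 k = (jtilde (fun h => -2 * f * δ h) (δ f) (fw h k)).1 k ∧
        (d (fw h k)).2 = 0) ∧
      ((d (fxi h k)).2 k = (jtilde (fun h => -2 * f * δ h) (δ f) (fxi h k)).2 k ∧
        (d (fxi h k)).1 = 0) := by
  induction hd using Submodule.span_induction with
  | mem d hd =>
    obtain ⟨u, v, p, hu, hv, rfl⟩ := hd
    exact ⟨isLin_Dgen δ _ _ _, u.2 0 * v.2 0, Dgen_diagonal δ hu hv⟩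
  | zero =>
    refine ⟨⟨by simp, by simp⟩, 0, fun h k => ?_⟩
    simp [jtilde]
  | add d e _ _ hd he =>
    obtain ⟨hd, f, hf⟩ := hd
    obtain ⟨he, g, hg⟩ := he
    refine ⟨⟨fun u v => ?_, fun c u => ?_⟩, f + g, fun h k => ?_⟩
    · simp only [Pi.add_apply, hd.1, he.1]; abel
    · simp only [Pi.add_apply, hd.2, he.2, smul_add]
    · obtain ⟨⟨a1, a2⟩, a3, a4⟩ := hf h k
      obtain ⟨⟨b1, b2⟩, b3, b4⟩ := hg h k
      refine ⟨⟨?_, ?_⟩, ?_, ?_⟩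
      · rw [Pi.add_apply, Prod.fst_add, Pi.add_apply, a1, b1]
        simp only [jtilde]; ring
      · rw [Pi.add_apply, Prod.snd_add, a2, b2, add_zero]
      · rw [Pi.add_apply, Prod.snd_add, Pi.add_apply, a3, b3]
        simp only [jtilde, map_add]; split_ifs <;> ring
      · rw [Pi.add_apply, Prod.fst_add, a4, b4, add_zero]
  | smul c d _ hd =>
    obtain ⟨hd, f, hf⟩ := hd
    refine ⟨⟨fun u v => ?_, fun r u => ?_⟩, c • f, fun h k => ?_⟩
    · simp only [Pi.smul_apply, hd.1, smul_add]
    · simp only [Pi.smul_apply, hd.2, smul_comm c r]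
    · obtain ⟨⟨a1, a2⟩, a3, a4⟩ := hf h k
      refine ⟨⟨?_, ?_⟩, ?_, ?_⟩
      · rw [Pi.smul_apply, Prod.smul_fst, Pi.smul_apply, a1]
        simp only [jtilde, mul_smul_comm, smul_mul_assoc]
      · rw [Pi.smul_apply, Prod.smul_snd, a2, smul_zero]
      · rw [Pi.smul_apply, Prod.smul_snd, Pi.smul_apply, a3]
        simp only [jtilde, δ.map_smul, mul_smul_comm, smul_mul_assoc]
        split_ifs
        · rw [smul_add]
        · rw [smul_sub]
      · rw [Pi.smul_apply, Prod.smul_fst, a4, smul_zero]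

theorem setOf_inder0_zero_zero :
    {d : J Z → J Z | d ∈ Submodule.span F (InderSet0 δ)
        ∧ DerDeg ((0, 0) : ZMod 2 × ZMod 2) d}
      = (Submodule.span F {d : J Z → J Z | ∃ f : Z,
          d = Dgen δ (-1) (fx (1 : Z)) (fx f)} : Set (J Z → J Z)) := by
  rw [span_Dgen_fx_coe]
  ext d
  constructor
  · rintro ⟨hd, ht⟩
    obtain ⟨hl, f, hf⟩ := exists_diagonal_of_mem_span δ hd
    have hidx : ∀ k : Fin 4, ∃ s, idx s = k := by decide
    have at0 : ∀ s : ZMod 2 × ZMod 2, s + (0, 0) = s := fun s => add_zero s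
    refine ⟨f, hl.eq_of_forall (isLin_Dgen δ _ _ _) (fun h k => ?_) fun h k => ?_⟩
    · rw [Dgen_fx_fx]
      obtain ⟨⟨a1, a2⟩, -⟩ := hf h k
      obtain ⟨s, rfl⟩ := hidx k
      refine Prod.ext (funext fun l => ?_) ?_
      · by_cases hl : l = idx s
        · rw [hl, a1]
        · rw [(ht s _ (fw_mem_gset h s) l (by rwa [at0])).1]
          simp [jtilde, fw, hl]
      · rw [a2]; funext l; simp [jtilde, fw]
    · rw [Dgen_fx_fx]
      obtain ⟨-, a3, a4⟩ := hf h k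
      obtain ⟨s, rfl⟩ := hidx k
      refine Prod.ext ?_ (funext fun l => ?_)
      · rw [a4]; funext l; simp [jtilde, fxi]
      · by_cases hl : l = idx s
        · rw [hl, a3]
        · rw [(ht s _ (fxi_mem_gset h s) l (by rwa [at0])).2]
          by_cases h0 : l = 0
          · subst h0
            simp [jtilde, fxi, hl]
          · simp [jtilde, fxi, hl, h0]
  · rintro ⟨f, rfl⟩
    refine ⟨Submodule.subset_span ⟨fx 1, fx f, true, rfl, rfl, rfl⟩, ?_⟩
    rw [Dgen_fx_fx]
    exact derDeg_jtilde (by simp) _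

end

end CKJ

theorem stmt9 {F : Type*} [Field F] (h2 : (2 : F) ≠ 0) {Z : Type*} [CommRing Z] [Algebra F Z]
    (δ : Derivation F Z Z)
    (hspan : Submodule.span F {z : Z | ∃ f g : Z, z = f * δ g} = ⊤) :
    -- (i)  Der(J)₀^{[0,0]} = {∂̃ : ∂ ∈ Der(K)₀}
    ({d : J Z → J Z | IsDer0 F (⇑δ) d ∧ DerDeg ((0, 0) : ZMod 2 × ZMod 2) d}
        = {d | ∃ (μ : Z → Z) (a : Z), IsKDer0 F (⇑δ) (kcheck μ a) ∧ d = jtilde μ a}) ∧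
    -- (ii)  Inder(J)₀^{[0,0]} = D(x, Zx) = {∂̃ : ∂ = (aδ)ˇ, a ∈ Z}
    ({d : J Z → J Z | d ∈ Submodule.span F (InderSet0 (⇑δ))
          ∧ DerDeg ((0, 0) : ZMod 2 × ZMod 2) d}
        = (Submodule.span F {d : J Z → J Z | ∃ f : Z,
            d = Dgen (⇑δ) (-1) (fx (1 : Z)) (fx f)} : Set (J Z → J Z))) ∧
    ((Submodule.span F {d : J Z → J Z | ∃ f : Z,
          d = Dgen (⇑δ) (-1) (fx (1 : Z)) (fx f)} : Set (J Z → J Z))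
        = {d | ∃ a a' : Z, 2 * a' = -δ a ∧ d = jtilde (fun h => a * δ h) a'}) ∧
    -- (iii)  Der(J)₀^{[1,0]} = D(w₂, Zw₃)
    ({d : J Z → J Z | IsDer0 F (⇑δ) d ∧ DerDeg ((1, 0) : ZMod 2 × ZMod 2) d}
        = (Submodule.span F {d : J Z → J Z | ∃ f : Z,
            d = Dgen (⇑δ) 1 (fw (1 : Z) 2) (fw f 3)} : Set (J Z → J Z))) ∧
    -- Der(J)₀^{[0,1]} = D(w₃, Zw₁)
    ({d : J Z → J Z | IsDer0 F (⇑δ) d ∧ DerDeg ((0, 1) : ZMod 2 × ZMod 2) d}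
        = (Submodule.span F {d : J Z → J Z | ∃ f : Z,
            d = Dgen (⇑δ) 1 (fw (1 : Z) 3) (fw f 1)} : Set (J Z → J Z))) ∧
    -- Der(J)₀^{[1,1]} = D(w₁, Zw₂)
    ({d : J Z → J Z | IsDer0 F (⇑δ) d ∧ DerDeg ((1, 1) : ZMod 2 × ZMod 2) d}
        = (Submodule.span F {d : J Z → J Z | ∃ f : Z,
            d = Dgen (⇑δ) 1 (fw (1 : Z) 1) (fw f 2)} : Set (J Z → J Z))) := by
  refine ⟨setOf_isDer0_zero_zero δ h2, setOf_inder0_zero_zero δ,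
    (span_Dgen_fx_coe δ).trans (setOf_Dgen_fx_eq δ h2), ?_, ?_, ?_⟩
  · refine setOf_isDer0_eq_span δ h2 hspan (t := (1, 0)) (a := (0, 1)) (b := (1, 1)) (by decide) (by decide)
      (by decide) (by decide) (by decide) (isDer0_Dgen_w_two_w_three δ) (derDeg_Dgen_w_two_w_three δ) fun f => ?_
    refine (Dgen_w_two_w_three_apply δ f _).trans (Prod.ext (fin4_funext ?_ ?_ ?_ ?_)
      (fin4_funext ?_ ?_ ?_ ?_)) <;> simp [fw, idx, wSq]
  · refine setOf_isDer0_eq_span δ h2 hspan (t := (0, 1)) (a := (1, 1)) (b := (1, 0)) (by decide) (by decide)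
      (by decide) (by decide) (by decide) (isDer0_Dgen_w_three_w_one δ) (derDeg_Dgen_w_three_w_one δ) fun f => ?_
    refine (Dgen_w_three_w_one_apply δ f _).trans (Prod.ext (fin4_funext ?_ ?_ ?_ ?_)
      (fin4_funext ?_ ?_ ?_ ?_)) <;> simp [fw, idx, wSq]
  · refine setOf_isDer0_eq_span δ h2 hspan (t := (1, 1)) (a := (1, 0)) (b := (0, 1)) (by decide) (by decide)
      (by decide) (by decide) (by decide) (isDer0_Dgen_w_one_w_two δ) (derDeg_Dgen_w_one_w_two δ) fun f => ?_
    refine (Dgen_w_one_w_two_apply δ f _).trans (Prod.ext (fin4_funext ?_ ?_ ?_ ?_)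
      (fin4_funext ?_ ?_ ?_ ?_)) <;> simp [fw, idx, wSq]
end

section
/- For the Cheng-Kac Jordan superalgebra J = JCK(Z,δ), the Lie superalgebra of inner derivations satisfies dim_F Inder(J) = dim_F J = 8·dim_F Z. -/
open CKJ

section

variable {F : Type*} [Field F] {Z : Type*} [CommRing Z] [Algebra F Z] (δ : Derivation F Z Z)

/-- The action on `c` of the inner derivation `innerOfCoord δ z`, in coordinates. -/
def innerOfCoordApply (z c : J Z) : J Z :=
  (![-2 * z.1 0 * δ (c.1 0) + z.2 0 * c.2 0 - z.2 1 * c.2 1 - z.2 2 * c.2 2 + z.2 3 * c.2 3,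
    -2 * z.1 0 * δ (c.1 1) + z.1 2 * c.1 3 - z.1 3 * c.1 2
      - z.2 1 * δ (c.2 0) + δ (z.2 1) * c.2 0 + z.2 2 * c.2 3 - z.2 3 * c.2 2,
    -2 * z.1 0 * δ (c.1 2) - z.1 1 * c.1 3 + z.1 3 * c.1 1
      - z.2 1 * c.2 3 - z.2 2 * δ (c.2 0) + δ (z.2 2) * c.2 0 + z.2 3 * c.2 1,
    -2 * z.1 0 * δ (c.1 3) - z.1 1 * c.1 2 + z.1 2 * c.1 1
      - z.2 1 * c.2 2 + z.2 2 * c.2 1 - z.2 3 * δ (c.2 0) + δ (z.2 3) * c.2 0],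
  ![-2 * z.1 0 * δ (c.2 0) + δ (z.1 0) * c.2 0
      - z.2 1 * c.1 1 - z.2 2 * c.1 2 + z.2 3 * c.1 3,
    -2 * z.1 0 * δ (c.2 1) - δ (z.1 0) * c.2 1 + δ (z.1 1) * c.2 0 + z.1 2 * c.2 3
      - z.1 3 * c.2 2 - z.2 0 * c.1 1 - z.2 1 * δ (c.1 0) + z.2 2 * δ (c.1 3)
      - z.2 3 * δ (c.1 2),
    -2 * z.1 0 * δ (c.2 2) - δ (z.1 0) * c.2 2 - z.1 1 * c.2 3 + δ (z.1 2) * c.2 0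
      + z.1 3 * c.2 1 - z.2 0 * c.1 2 - z.2 1 * δ (c.1 3) - z.2 2 * δ (c.1 0)
      + z.2 3 * δ (c.1 1),
    -2 * z.1 0 * δ (c.2 3) - δ (z.1 0) * c.2 3 - z.1 1 * c.2 2 + z.1 2 * c.2 1
      + δ (z.1 3) * c.2 0 - z.2 0 * c.1 3 - z.2 1 * δ (c.1 2) + z.2 2 * δ (c.1 1)
      - z.2 3 * δ (c.1 0)])

theorem innerOfCoordApply_add (z z' c : J Z) :
    innerOfCoordApply δ (z + z') c = innerOfCoordApply δ z c + innerOfCoordApply δ z' c := by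
  refine Prod.ext (funext fun k => ?_) (funext fun k => ?_) <;> fin_cases k <;>
    simp [innerOfCoordApply] <;> ring

theorem innerOfCoordApply_smul (r : F) (z c : J Z) :
    innerOfCoordApply δ (r • z) c = r • innerOfCoordApply δ z c := by
  refine Prod.ext (funext fun k => ?_) (funext fun k => ?_) <;> fin_cases k <;>
    simp [innerOfCoordApply] <;> simp only [Algebra.smul_def] <;> ring

/-- The inner derivation of `JCK(Z,δ)` with coordinates `z`: if `p` and `q` are the even and the odd
coordinates of `z`, it is the sum of `D(p₀x, x)`, `D(pₖx, xₖ)`, `D(q₀w₁, x₁)` and `D(qₖwₖ, x)` for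
`k = 1, 2, 3`. -/
def innerOfCoord : J Z →ₗ[F] (J Z → J Z) where
  toFun := innerOfCoordApply δ
  map_add' z z' := funext (innerOfCoordApply_add δ z z')
  map_smul' r z := funext (innerOfCoordApply_smul δ r z)

theorem Dgen_even_even (a b : Fin 4 → Z) :
    Dgen δ 1 (a, 0) (b, 0) = innerOfCoord δ
      (![0, a 2 * b 3 - a 3 * b 2, a 3 * b 1 - a 1 * b 3, a 2 * b 1 - a 1 * b 2], 0) := by
  funext c
  refine Prod.ext (funext fun k => ?_) (funext fun k => ?_) <;> fin_cases k <;>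
    simp [innerOfCoord, innerOfCoordApply, Dgen, jmul, emul, omul, eomul] <;> ring

theorem Dgen_odd_odd (a b : Fin 4 → Z) :
    Dgen δ (-1) (0, a) (0, b) = innerOfCoord δ
      (![a 0 * b 0, a 0 * b 1 + a 1 * b 0, a 0 * b 2 + a 2 * b 0, a 0 * b 3 + a 3 * b 0], 0) := by
  funext c
  refine Prod.ext (funext fun k => ?_) (funext fun k => ?_) <;> fin_cases k <;>
    simp [innerOfCoord, innerOfCoordApply, Dgen, jmul, emul, omul, eomul] <;> ring

theorem Dgen_even_odd (a b : Fin 4 → Z) :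
    Dgen δ 1 (a, 0) (0, b) = innerOfCoord δ
      (0, ![b 0 * δ (a 0) + a 1 * b 1 + a 2 * b 2 - a 3 * b 3,
        a 1 * b 0, a 2 * b 0, a 3 * b 0]) := by
  funext c
  refine Prod.ext (funext fun k => ?_) (funext fun k => ?_) <;> fin_cases k <;>
    simp [innerOfCoord, innerOfCoordApply, Dgen, jmul, emul, omul, eomul] <;> ring

theorem Dgen_one_swap (u v : J Z) : Dgen δ 1 v u = -Dgen δ 1 u v := by
  funext c
  simp [Dgen]

theorem Dgen_mem_range {u v : J Z} {p q : Bool} (hu : IsHom p u) (hv : IsHom q v) :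
    Dgen δ (sgn p q) u v ∈ LinearMap.range (innerOfCoord δ) := by
  obtain ⟨a, b⟩ := u
  obtain ⟨a', b'⟩ := v
  cases p <;> cases q <;> simp only [IsHom, Bool.false_eq_true, if_true, if_false] at hu hv <;>
    subst hu hv
  · exact ⟨_, (Dgen_even_even δ a a').symm⟩
  · exact ⟨_, (Dgen_even_odd δ a b').symm⟩
  · have h : Dgen δ 1 (0, b) (a', 0) ∈ LinearMap.range (innerOfCoord δ) := by
      rw [Dgen_one_swap]
      exact neg_mem ⟨_, (Dgen_even_odd δ a' b).symm⟩
    exact h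
  · exact ⟨_, (Dgen_odd_odd δ b b').symm⟩

theorem innerOfCoord_eq_sum_Dgen (z : J Z) :
    innerOfCoord δ z =
      Dgen δ (-1) (0, ![z.1 0, 0, 0, 0]) (0, ![1, 0, 0, 0]) +
      Dgen δ (-1) (0, ![1, 0, 0, 0]) (0, ![0, z.1 1, z.1 2, z.1 3]) +
      Dgen δ 1 (![0, z.2 0, 0, 0], 0) (0, ![0, 1, 0, 0]) +
      Dgen δ 1 (![0, z.2 1, z.2 2, z.2 3], 0) (0, ![1, 0, 0, 0]) := by
  rw [Dgen_odd_odd, Dgen_odd_odd, Dgen_even_odd, Dgen_even_odd, ← map_add, ← map_add, ← map_add]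
  congr 1
  refine Prod.ext (funext fun k => ?_) (funext fun k => ?_) <;> fin_cases k <;> simp

theorem span_InderSet :
    Submodule.span F (InderSet δ) = LinearMap.range (innerOfCoord δ) := by
  refine le_antisymm (Submodule.span_le.2 ?_) ?_
  · rintro _ ⟨u, v, p, q, hu, hv, rfl⟩
    exact Dgen_mem_range δ hu hv
  · rintro _ ⟨z, rfl⟩
    rw [innerOfCoord_eq_sum_Dgen]
    refine add_mem (add_mem (add_mem ?_ ?_) ?_) ?_ <;> refine Submodule.subset_span ?_
    · exact ⟨(0, _), (0, _), true, true, by simp [IsHom], by simp [IsHom], rfl⟩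
    · exact ⟨(0, _), (0, _), true, true, by simp [IsHom], by simp [IsHom], rfl⟩
    · exact ⟨(_, 0), (0, _), false, true, by simp [IsHom], by simp [IsHom], rfl⟩
    · exact ⟨(_, 0), (0, _), false, true, by simp [IsHom], by simp [IsHom], rfl⟩

variable {δ}

theorem eq_zero_of_mul_derivation_eq_zero
    (hspan : Submodule.span F {z : Z | ∃ f g : Z, z = f * δ g} = ⊤)
    {p : Z} (hp : ∀ h, p * δ h = 0) : p = 0 := by
  have h1 : (1 : Z) ∈ Submodule.span F {z : Z | ∃ f g : Z, z = f * δ g} := hspan ▸ trivial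
  have h : Submodule.span F {z : Z | ∃ f g : Z, z = f * δ g} ≤
      LinearMap.ker (LinearMap.mulLeft F p) := by
    refine Submodule.span_le.2 ?_
    rintro _ ⟨f, g, rfl⟩
    simp [mul_left_comm p f, hp]
  simpa using h h1

theorem innerOfCoord_injective (h2 : (2 : F) ≠ 0)
    (hspan : Submodule.span F {z : Z | ∃ f g : Z, z = f * δ g} = ⊤) :
    Function.Injective (innerOfCoord δ) := by
  have cancel_two {y : Z} (hy : 2 * y = 0) : y = 0 := by
    have : (2 : F) • y = 0 := by rw [Algebra.smul_def, map_ofNat, hy]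
    exact (smul_eq_zero_iff_right h2).1 this
  rw [← LinearMap.ker_eq_bot, LinearMap.ker_eq_bot']
  rintro ⟨p, q⟩ hz
  have hw (k : Fin 4) (f : Z) : innerOfCoordApply δ (p, q) (fw f k) = 0 := congrFun hz _
  have he (k : Fin 4) (f : Z) (l : Fin 4) := congrFun (congrArg Prod.fst (hw k f)) l
  have ho (k : Fin 4) (f : Z) (l : Fin 4) := congrFun (congrArg Prod.snd (hw k f)) l
  have hp0 : p 0 = 0 := eq_zero_of_mul_derivation_eq_zero hspan fun h => cancel_two <| by
    simpa [innerOfCoordApply, fw, mul_assoc] using he 0 h 0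
  have hp1 : p 1 = 0 := by simpa [innerOfCoordApply, fw] using he 2 1 3
  have hp2 : p 2 = 0 := by simpa [innerOfCoordApply, fw] using he 1 1 3
  have hp3 : p 3 = 0 := by simpa [innerOfCoordApply, fw] using he 1 1 2
  have hq0 : q 0 = 0 := by simpa [innerOfCoordApply, fw] using ho 1 1 1
  have hq1 : q 1 = 0 := eq_zero_of_mul_derivation_eq_zero hspan fun h => by
    simpa [innerOfCoordApply, fw] using ho 0 h 1
  have hq2 : q 2 = 0 := eq_zero_of_mul_derivation_eq_zero hspan fun h => by
    simpa [innerOfCoordApply, fw] using ho 0 h 2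
  have hq3 : q 3 = 0 := eq_zero_of_mul_derivation_eq_zero hspan fun h => by
    simpa [innerOfCoordApply, fw] using ho 0 h 3
  refine Prod.ext (funext fun k => ?_) (funext fun k => ?_) <;> fin_cases k <;> assumption

end

theorem stmt13 {F : Type*} [Field F] (h2 : (2 : F) ≠ 0) {Z : Type*} [CommRing Z] [Algebra F Z]
    (δ : Derivation F Z Z)
    (hspan : Submodule.span F {z : Z | ∃ f g : Z, z = f * δ g} = ⊤) :
    -- dim_F Inder(J) = dim_F J = 8 · dim_F Z
    Module.rank F ↥(Submodule.span F (InderSet (⇑δ))) = 8 * Module.rank F Z ∧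
    Module.rank F (J Z) = 8 * Module.rank F Z := by
  have hJ : Module.rank F (J Z) = 8 * Module.rank F Z := by
    rw [rank_prod', rank_fun_eq_lift_mul, Cardinal.lift_uzero, ← add_mul, Fintype.card_fin]
    norm_num
  refine ⟨?_, hJ⟩
  rw [span_InderSet, rank_range_of_injective _ (innerOfCoord_injective h2 hspan), hJ]
end
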